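/- Let A ∈ ℝ^{n×N}, τ, λ > 0, Y ∈ ℝ^{n×m}, L ≥ 2, B_out > 0, and let (ε_{ik})_{i∈[m],k∈[N]} be independent Rademacher random variables (each uniform on {−1, +1}). Then E_ε sup_{Ψ,Φ ∈ O(N)} (1/m) Σ_{i=1}^m Σ_{k=1}^N ε_{ik}·[σ(Ψ f_Φ^L(Y))]_{k,i} ≤ 2√2·B_out·(N/√m)·√(log(e(1 + 8M_L/(√m·B_out)))) + 2√2·B_out·√(Nn/m)·√(log(e(1 + 8K_L‖A‖_{2→2}/(√m·B_out)))), where M_L = τ‖A‖_{2→2}‖Y‖_F Σ_{k=0}^{L−1} ‖I − τAᵀA‖_{2→2}^k and K_L = τ‖Y‖_F‖I − τAᵀA‖_{2→2}^{L−1} + τ‖Y‖_F Σ_{l=2}^{L} ‖I − τAᵀA‖_{2→2}^{L−l}(1 + 2τ‖A‖²_{2→2} Σ_{k=0}^{l−2} ‖I − τAᵀA‖_{2→2}^k). -/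

import Mathlib

open MeasureTheory Matrix
open scoped ENNReal

noncomputable def soft (mu x : ℝ) : ℝ := Real.sign x * max 0 (|x| - mu)

noncomputable def softMat {a b : ℕ} (mu : ℝ) (M : Matrix (Fin a) (Fin b) ℝ) :
    Matrix (Fin a) (Fin b) ℝ := Matrix.of fun i j => soft mu (M i j)

noncomputable def specNorm {a b : ℕ} (A : Matrix (Fin a) (Fin b) ℝ) : ℝ :=
  ‖LinearMap.toContinuousLinearMap (Matrix.toEuclideanLin A)‖

noncomputable def frobNorm {a b : ℕ} (A : Matrix (Fin a) (Fin b) ℝ) : ℝ :=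
  Real.sqrt (∑ i, ∑ j, (A i j) ^ 2)

noncomputable def l2 {N : ℕ} (x : Fin N → ℝ) : ℝ := Real.sqrt (∑ i, x i ^ 2)

noncomputable def sigma {N : ℕ} (B : ℝ) (x : Fin N → ℝ) : Fin N → ℝ :=
  if l2 x ≤ B then x else (B / l2 x) • x

noncomputable def sigmaMat {N m : ℕ} (B : ℝ) (M : Matrix (Fin N) (Fin m) ℝ) :
    Matrix (Fin N) (Fin m) ℝ := Matrix.of fun i j => sigma B (fun k => M k j) i

def IsOrthogonal {N : ℕ} (Φ : Matrix (Fin N) (Fin N) ℝ) : Prop := Φᵀ * Φ = 1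

noncomputable def ista {n N m : ℕ} (A : Matrix (Fin n) (Fin N) ℝ) (τ lam : ℝ)
    (Φ : Matrix (Fin N) (Fin N) ℝ) (Y : Matrix (Fin n) (Fin m) ℝ) :
    ℕ → Matrix (Fin N) (Fin m) ℝ
  | 0 => 0
  | l + 1 => softMat (τ * lam)
      ((1 - τ • (Φᵀ * Aᵀ * A * Φ)) * ista A τ lam Φ Y l + τ • ((A * Φ)ᵀ * Y))

noncomputable def istaVec {n N : ℕ} (A : Matrix (Fin n) (Fin N) ℝ) (τ lam : ℝ)
    (Φ : Matrix (Fin N) (Fin N) ℝ) (y : Fin n → ℝ) : ℕ → Fin N → ℝ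
  | 0 => 0
  | l + 1 => soft (τ * lam) ∘
      ((1 - τ • (Φᵀ * Aᵀ * A * Φ)) *ᵥ istaVec A τ lam Φ y l + τ • ((A * Φ)ᵀ *ᵥ y))

noncomputable def KL {n N m : ℕ} (A : Matrix (Fin n) (Fin N) ℝ) (τ : ℝ)
    (Y : Matrix (Fin n) (Fin m) ℝ) (L : ℕ) : ℝ :=
  τ * frobNorm Y * specNorm (1 - τ • (Aᵀ * A)) ^ (L - 1)
    + τ * frobNorm Y * ∑ l ∈ Finset.Icc 2 L,
        specNorm (1 - τ • (Aᵀ * A)) ^ (L - l) *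
          (1 + 2 * τ * specNorm A ^ 2 *
            ∑ k ∈ Finset.range (l - 1), specNorm (1 - τ • (Aᵀ * A)) ^ k)

noncomputable def ML {n N m : ℕ} (A : Matrix (Fin n) (Fin N) ℝ) (τ : ℝ)
    (Y : Matrix (Fin n) (Fin m) ℝ) (L : ℕ) : ℝ :=
  τ * specNorm A * frobNorm Y * ∑ k ∈ Finset.range L, specNorm (1 - τ • (Aᵀ * A)) ^ k

noncomputable def coveringNumber {α : Type*} (d : α → α → ℝ) (s : Set α) (ε : ℝ) : ℝ≥0∞ :=
  ⨅ (t : Finset α) (_ : ∀ x ∈ s, ∃ y ∈ t, d x y ≤ ε), (t.card : ℝ≥0∞)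


open scoped Function in
theorem aux_card_le {E : Type*} [NormedAddCommGroup E] [NormedSpace ℝ E] [FiniteDimensional ℝ E]
    (s : Finset E) (R d : ℝ) (hR : 0 ≤ R) (hd : 0 < d) (hs : ∀ c ∈ s, ‖c‖ ≤ R)
    (h : ∀ c ∈ s, ∀ x ∈ s, c ≠ x → d ≤ ‖c - x‖) :
    (s.card : ℝ) ≤ (1 + 2 * R / d) ^ Module.finrank ℝ E := by
  borelize E
  let μ : Measure E := Measure.addHaar
  have hδ : 0 < d / 2 := by positivity
  have ρpos : 0 < R + d / 2 := by positivity
  have D : Set.Pairwise (s : Set E) (Disjoint on fun c => Metric.ball (c : E) (d / 2)) := by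
    rintro c hc x hx hcd
    apply Metric.ball_disjoint_ball
    rw [dist_eq_norm]
    have := h c hc x hx hcd
    linarith
  have A_subset : (⋃ c ∈ s, Metric.ball (c : E) (d / 2)) ⊆ Metric.ball (0 : E) (R + d / 2) := by
    refine Set.iUnion₂_subset fun x hx => ?_
    apply Metric.ball_subset_ball'
    rw [dist_zero_right]
    linarith [hs x hx]
  have I : (s.card : ℝ≥0∞) * ENNReal.ofReal ((d / 2) ^ Module.finrank ℝ E) * μ (Metric.ball 0 1) ≤
      ENNReal.ofReal ((R + d / 2) ^ Module.finrank ℝ E) * μ (Metric.ball 0 1) :=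
    calc
      _ = μ (⋃ c ∈ s, Metric.ball (c : E) (d / 2)) := by
        rw [measure_biUnion_finset D fun c _ => measurableSet_ball]
        simp only [μ.addHaar_ball_of_pos _ hδ]
        simp only [Finset.sum_const, nsmul_eq_mul, mul_assoc]
      _ ≤ μ (Metric.ball (0 : E) (R + d / 2)) := measure_mono A_subset
      _ = _ := by simp only [μ.addHaar_ball_of_pos _ ρpos]
  have J : (s.card : ℝ≥0∞) * ENNReal.ofReal ((d / 2) ^ Module.finrank ℝ E) ≤
      ENNReal.ofReal ((R + d / 2) ^ Module.finrank ℝ E) := by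
    rwa [ENNReal.mul_le_mul_iff_left (Metric.measure_ball_pos _ _ zero_lt_one).ne'
      measure_ball_lt_top.ne] at I
  have K : (s.card : ℝ) * (d / 2) ^ Module.finrank ℝ E ≤ (R + d / 2) ^ Module.finrank ℝ E := by
    have := ENNReal.toReal_le_of_le_ofReal (by positivity) J
    simpa [ENNReal.toReal_mul, ENNReal.toReal_ofReal, hδ.le, hd.le] using this
  have : 1 + 2 * R / d = (R + d / 2) / (d / 2) := by field_simp; ring
  rw [this, div_pow, le_div_iff₀ (by positivity)]
  exact K

theorem aux_cover {E : Type*} [NormedAddCommGroup E] [NormedSpace ℝ E] [FiniteDimensional ℝ E]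
    (S : Set E) (hne : S.Nonempty) (R K ε : ℝ) (hR : 0 ≤ R) (hK : 0 ≤ K) (hε : 0 < ε)
    (hS : ∀ x ∈ S, ‖x‖ ≤ R) :
    ∃ T : Finset E, (∀ x ∈ T, x ∈ S) ∧ (T.card : ℝ) ≤ (1 + 2 * R * K / ε) ^ Module.finrank ℝ E ∧
      ∀ x ∈ S, ∃ y ∈ T, K * ‖x - y‖ ≤ ε := by
  classical
  rcases hK.eq_or_lt with rfl | hK
  · obtain ⟨x, hx⟩ := hne
    exact ⟨{x}, by simpa using hx, by simp, fun y _ => ⟨x, by simp, by simpa using hε.le⟩⟩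
  set d := ε / K with hd
  have hd0 : 0 < d := by positivity
  have key : ∃ T : Finset E, (∀ x ∈ T, x ∈ S) ∧ (∀ c ∈ T, ∀ x ∈ T, c ≠ x → d ≤ ‖c - x‖) ∧
      ∀ x ∈ S, ∃ y ∈ T, ‖x - y‖ < d := by
    by_contra hcon
    push Not at hcon
    have step : ∀ k : ℕ, ∃ T : Finset E, (∀ x ∈ T, x ∈ S) ∧
        (∀ c ∈ T, ∀ x ∈ T, c ≠ x → d ≤ ‖c - x‖) ∧ T.card = k := by
      intro k
      induction k with
      | zero => exact ⟨∅, by simp, by simp, by simp⟩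
      | succ k ih =>
        obtain ⟨T, h1, h2, h3⟩ := ih
        obtain ⟨x, hx, hxT⟩ := hcon T h1 h2
        have hnot : x ∉ T := fun hmem => by
          have := hxT x hmem
          simp at this
          linarith
        refine ⟨insert x T, ?_, ?_, ?_⟩
        · intro y hy
          rcases Finset.mem_insert.1 hy with rfl | hy
          · exact hx
          · exact h1 y hy
        · intro c hc y hy hcy
          rcases Finset.mem_insert.1 hc with hc1 | hc1 <;>
            rcases Finset.mem_insert.1 hy with hy1 | hy1
          · exact absurd (hc1.trans hy1.symm) hcy
          · rw [hc1]; exact hxT y hy1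
          · rw [norm_sub_rev, hy1]; exact hxT c hc1
          · exact h2 c hc1 y hy1 hcy
        · rw [Finset.card_insert_of_notMem hnot, h3]
    obtain ⟨k, hk⟩ := exists_nat_gt ((1 + 2 * R / d) ^ Module.finrank ℝ E)
    obtain ⟨T, h1, h2, h3⟩ := step k
    have := aux_card_le T R d hR hd0 (fun c hc => hS c (h1 c hc)) h2
    rw [h3] at this
    linarith
  obtain ⟨T, h1, h2, h3⟩ := key
  refine ⟨T, h1, ?_, ?_⟩
  · have := aux_card_le T R d hR hd0 (fun c hc => hS c (h1 c hc)) h2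
    have h4 : 2 * R * K / ε = 2 * R / d := by rw [hd]; field_simp
    rwa [h4]
  · intro x hx
    obtain ⟨y, hy, hxy⟩ := h3 x hx
    refine ⟨y, hy, ?_⟩
    rw [hd, lt_div_iff₀ hK] at hxy
    linarith

/-- Rademacher pairing -/
noncomputable def rad {ι : Type*} [Fintype ι] (e : ι → Bool) (v : EuclideanSpace ℝ ι) : ℝ :=
  ∑ i, (if e i then (1 : ℝ) else -1) * v i

theorem rad_sub {ι : Type*} [Fintype ι] (e : ι → Bool) (v w : EuclideanSpace ℝ ι) :
    rad e (v - w) = rad e v - rad e w := by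
  simp [rad, mul_sub, Finset.sum_sub_distrib]

theorem rad_abs_le {ι : Type*} [Fintype ι] (e : ι → Bool) (v : EuclideanSpace ℝ ι) :
    rad e v ≤ Real.sqrt (Fintype.card ι) * ‖v‖ := by
  have := Real.sum_mul_le_sqrt_mul_sqrt Finset.univ (fun i => (if e i then (1 : ℝ) else -1))
    (fun i => v i)
  rw [EuclideanSpace.norm_eq]
  have h2 : ∑ i : ι, (if e i then (1 : ℝ) else -1) ^ 2 = Fintype.card ι := by
    simp [Finset.card_univ]
  rw [h2] at this
  simpa [rad] using this

theorem rad_mgf {ι : Type*} [Fintype ι] [DecidableEq ι] (v : EuclideanSpace ℝ ι) (θ : ℝ) :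
    (1 / 2 ^ (Fintype.card ι) : ℝ) * ∑ e : ι → Bool, Real.exp (θ * rad e v) ≤
      Real.exp (θ ^ 2 * ‖v‖ ^ 2 / 2) := by
  have h1 : ∀ e : ι → Bool, Real.exp (θ * rad e v) =
      ∏ i, Real.exp ((if e i then (1 : ℝ) else -1) * (θ * v i)) := by
    intro e
    rw [← Real.exp_sum, rad, Finset.mul_sum]
    congr 1
    apply Finset.sum_congr rfl
    intros; ring
  have h2 : ∑ e : ι → Bool, Real.exp (θ * rad e v) =
      ∏ i, ∑ b : Bool, Real.exp ((if b then (1 : ℝ) else -1) * (θ * v i)) := by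
    rw [Finset.prod_univ_sum, Fintype.piFinset_univ]
    exact Finset.sum_congr rfl fun e _ => h1 e
  have h3 : ∀ i, ∑ b : Bool, Real.exp ((if b then (1 : ℝ) else -1) * (θ * v i)) =
      2 * Real.cosh (θ * v i) := by
    intro i
    rw [Real.cosh_eq]
    simp
    ring
  have h4 : (1 / 2 ^ (Fintype.card ι) : ℝ) * ∑ e : ι → Bool, Real.exp (θ * rad e v) =
      ∏ i, Real.cosh (θ * v i) := by
    rw [h2]
    simp_rw [h3]
    rw [Finset.prod_mul_distrib]
    simp [Finset.card_univ]
  rw [h4]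
  calc _ ≤ ∏ i, Real.exp ((θ * v i) ^ 2 / 2) :=
        Finset.prod_le_prod (fun i _ => (Real.cosh_pos _).le) fun i _ => Real.cosh_le_exp_half_sq _
    _ = _ := by
      rw [← Real.exp_sum, EuclideanSpace.norm_sq_eq]
      congr 1
      rw [Finset.mul_sum, Finset.sum_div]
      apply Finset.sum_congr rfl
      intro i _
      rw [Real.norm_eq_abs, sq_abs]
      ring

theorem rad_max {ι J : Type*} [Fintype ι] [DecidableEq ι] (T : Finset J)
    (v : J → EuclideanSpace ℝ ι) (r : ℝ) (hr : 0 < r) (hv : ∀ j ∈ T, ‖v j‖ ≤ r)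
    (s : (ι → Bool) → J) (hs : ∀ e, s e ∈ T) :
    (1 / 2 ^ (Fintype.card ι) : ℝ) * ∑ e : ι → Bool, rad e (v (s e)) ≤
      r * Real.sqrt (2 * Real.log T.card) := by
  set Z := (1 / 2 ^ (Fintype.card ι) : ℝ) * ∑ e : ι → Bool, rad e (v (s e)) with hZ
  have hcard : (1 : ℝ) ≤ T.card := by
    have : 0 < T.card := Finset.card_pos.2 ⟨_, hs (fun _ => true)⟩
    exact_mod_cast this
  have key : ∀ θ : ℝ, θ * Z ≤ Real.log T.card + θ ^ 2 * r ^ 2 / 2 := by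
    intro θ
    have hw : ∑ _e : ι → Bool, (1 / 2 ^ (Fintype.card ι) : ℝ) = 1 := by
      simp [Finset.card_univ]
    have jen := convexOn_exp.map_sum_le (t := (Finset.univ : Finset (ι → Bool)))
      (w := fun _ => (1 / 2 ^ (Fintype.card ι) : ℝ)) (p := fun e => θ * rad e (v (s e)))
      (fun _ _ => by positivity) hw (fun _ _ => Set.mem_univ _)
    simp only [smul_eq_mul] at jen
    rw [← Finset.mul_sum, ← Finset.mul_sum, ← Finset.mul_sum] at jen
    have e1 : (1 / 2 ^ (Fintype.card ι) : ℝ) * (θ * ∑ e : ι → Bool, rad e (v (s e))) = θ * Z := by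
      rw [hZ]; ring
    rw [e1] at jen
    have b1 : (1 / 2 ^ (Fintype.card ι) : ℝ) * ∑ e : ι → Bool, Real.exp (θ * rad e (v (s e))) ≤
        ∑ j ∈ T, Real.exp (θ ^ 2 * r ^ 2 / 2) := by
      calc _ ≤ (1 / 2 ^ (Fintype.card ι) : ℝ) * ∑ e : ι → Bool, ∑ j ∈ T,
            Real.exp (θ * rad e (v j)) := by
            gcongr with e
            exact Finset.single_le_sum (f := fun j => Real.exp (θ * rad e (v j)))
              (fun j _ => (Real.exp_pos _).le) (hs e)
        _ = ∑ j ∈ T, (1 / 2 ^ (Fintype.card ι) : ℝ) * ∑ e : ι → Bool,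
            Real.exp (θ * rad e (v j)) := by
            rw [Finset.sum_comm, Finset.mul_sum]
        _ ≤ _ := by
            apply Finset.sum_le_sum
            intro j hj
            refine (rad_mgf (v j) θ).trans ?_
            have := hv j hj
            gcongr
    have b2 := jen.trans b1
    rw [Finset.sum_const, nsmul_eq_mul] at b2
    have b3 := Real.log_le_log (Real.exp_pos _) b2
    rwa [Real.log_exp, Real.log_mul (by positivity) (Real.exp_pos _).ne', Real.log_exp] at b3
  have hl : 0 ≤ Real.log T.card := Real.log_nonneg hcard
  have h1 := key (Z / r ^ 2)
  have h2 : Z ^ 2 ≤ r ^ 2 * (2 * Real.log T.card) := by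
    have h3 : Z / r ^ 2 * Z = Z ^ 2 / r ^ 2 := by ring
    have h4 : (Z / r ^ 2) ^ 2 * r ^ 2 / 2 = (Z ^ 2 / r ^ 2) / 2 := by field_simp
    rw [h3, h4] at h1
    have h5 : Z ^ 2 / r ^ 2 ≤ 2 * Real.log T.card := by linarith
    rw [div_le_iff₀ (by positivity)] at h5
    linarith
  calc Z ≤ Real.sqrt (Z ^ 2) := by rw [Real.sqrt_sq_eq_abs]; exact le_abs_self _
    _ ≤ Real.sqrt (r ^ 2 * (2 * Real.log T.card)) := Real.sqrt_le_sqrt h2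
    _ = _ := by rw [Real.sqrt_mul (by positivity), Real.sqrt_sq hr.le]

theorem rad_chain {ι : Type*} [Fintype ι] [DecidableEq ι] (S : Set (EuclideanSpace ℝ ι))
    (R : ℝ) (hR : 0 < R) (hS : ∀ x ∈ S, ‖x‖ ≤ R)
    (T : ℕ → Finset (EuclideanSpace ℝ ι)) (hT : ∀ k, ∀ x ∈ T k, x ∈ S)
    (hcov : ∀ k, ∀ x ∈ S, ∃ y ∈ T k, ‖x - y‖ ≤ R / 2 ^ (k + 1)) (K : ℕ)
    (s : (ι → Bool) → EuclideanSpace ℝ ι) (hs : ∀ e, s e ∈ T K) :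
    (1 / 2 ^ (Fintype.card ι) : ℝ) * ∑ e : ι → Bool, rad e (s e) ≤
      ∑ k ∈ Finset.range (K + 1), R / 2 ^ k * Real.sqrt (2 * Real.log (T k).card) := by
  induction K generalizing s with
  | zero =>
    have := rad_max (T 0) id R hR (fun j hj => hS j (hT 0 j hj)) s hs
    simpa using this
  | succ K ih =>
    have hex : ∀ x, ∃ y, x ∈ S → y ∈ T K ∧ ‖x - y‖ ≤ R / 2 ^ (K + 1) := by
      intro x
      by_cases hx : x ∈ S
      · obtain ⟨y, h1, h2⟩ := hcov K x hx
        exact ⟨y, fun _ => ⟨h1, h2⟩⟩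
      · exact ⟨0, fun h => absurd h hx⟩
    choose p hp using hex
    have h1 := rad_max (T (K + 1)) (fun x => x - p x) (R / 2 ^ (K + 1)) (by positivity)
      (fun j hj => (hp j (hT _ j hj)).2) s hs
    have h2 := ih (fun e => p (s e)) (fun e => (hp _ (hT _ _ (hs e))).1)
    rw [Finset.sum_range_succ]
    simp only [rad_sub, Finset.sum_sub_distrib, mul_sub] at h1
    linarith

theorem weight_sum (K : ℕ) : ∑ k ∈ Finset.range K, (1 / 2 ^ (k + 1) : ℝ) = 1 - 1 / 2 ^ K := by
  induction K with
  | zero => simp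
  | succ K ih => rw [Finset.sum_range_succ, ih, pow_succ]; field_simp; ring

theorem weight_sum2 (K : ℕ) :
    ∑ k ∈ Finset.range K, (1 / 2 ^ (k + 1) : ℝ) * k = 1 - (K + 1) / 2 ^ K := by
  induction K with
  | zero => simp
  | succ K ih => rw [Finset.sum_range_succ, ih, pow_succ]; push_cast; field_simp; ring

theorem entropy_sum (r a : ℝ) (hr : 0 < r) (ha : 0 ≤ a) (K : ℕ) :
    ∑ k ∈ Finset.range K, (1 / 2 ^ (k + 1) : ℝ) * Real.sqrt (Real.log (1 + a / (r / 2 ^ k))) ≤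
      Real.sqrt (Real.log (Real.exp 1 * (1 + a / r))) := by
  have hlog : 0 ≤ Real.log (1 + a / r) := Real.log_nonneg (by have : 0 ≤ a / r := by positivity
                                                              linarith)
  have hpt : ∀ k : ℕ, 0 ≤ Real.log (1 + a / (r / 2 ^ k)) := fun k =>
    Real.log_nonneg (by have : 0 ≤ a / (r / 2 ^ k) := by positivity
                        linarith)
  have hle : ∀ k : ℕ, Real.log (1 + a / (r / 2 ^ k)) ≤ k + Real.log (1 + a / r) := by
    intro k
    have h1 : 1 + a / (r / 2 ^ k) ≤ 2 ^ k * (1 + a / r) := by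
      have : a / (r / 2 ^ k) = 2 ^ k * (a / r) := by field_simp
      rw [this, mul_add]
      have : (1 : ℝ) ≤ 2 ^ k := one_le_pow₀ (by norm_num)
      linarith
    have h2 := Real.log_le_log (by positivity) h1
    rw [Real.log_mul (by positivity) (by positivity), Real.log_pow] at h2
    have h3 : (k : ℝ) * Real.log 2 ≤ k * 1 := by
      gcongr
      linarith [Real.log_two_lt_d9]
    linarith
  apply Real.le_sqrt_of_sq_le
  rw [Real.log_mul (Real.exp_pos _).ne' (by positivity), Real.log_exp]
  have cs := Finset.sum_mul_sq_le_sq_mul_sq (Finset.range K)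
    (fun k : ℕ => Real.sqrt (1 / 2 ^ (k + 1)))
    (fun k : ℕ => Real.sqrt (1 / 2 ^ (k + 1)) * Real.sqrt (Real.log (1 + a / (r / 2 ^ k))))
  have e1 : ∀ k : ℕ, Real.sqrt (1 / 2 ^ (k + 1)) *
      (Real.sqrt (1 / 2 ^ (k + 1)) * Real.sqrt (Real.log (1 + a / (r / 2 ^ k)))) =
      (1 / 2 ^ (k + 1) : ℝ) * Real.sqrt (Real.log (1 + a / (r / 2 ^ k))) := by
    intro k
    rw [← mul_assoc, Real.mul_self_sqrt (by positivity)]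
  have e2 : ∀ k : ℕ, Real.sqrt (1 / 2 ^ (k + 1)) ^ 2 = (1 / 2 ^ (k + 1) : ℝ) := by
    intro k; rw [Real.sq_sqrt (by positivity)]
  have e3 : ∀ k : ℕ, (Real.sqrt (1 / 2 ^ (k + 1)) *
      Real.sqrt (Real.log (1 + a / (r / 2 ^ k)))) ^ 2 =
      (1 / 2 ^ (k + 1) : ℝ) * Real.log (1 + a / (r / 2 ^ k)) := by
    intro k
    rw [mul_pow, e2, Real.sq_sqrt (hpt k)]
  simp only [e1, e2, e3] at cs
  refine cs.trans ?_
  have w1 : ∑ k ∈ Finset.range K, (1 / 2 ^ (k + 1) : ℝ) ≤ 1 := by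
    rw [weight_sum]; have : (0 : ℝ) < 1 / 2 ^ K := by positivity
    linarith
  have w2 : ∑ k ∈ Finset.range K, (1 / 2 ^ (k + 1) : ℝ) * k ≤ 1 := by
    rw [weight_sum2]; have : (0 : ℝ) < (K + 1) / 2 ^ K := by positivity
    linarith
  have w3 : ∑ k ∈ Finset.range K, (1 / 2 ^ (k + 1) : ℝ) * Real.log (1 + a / (r / 2 ^ k)) ≤
      1 + Real.log (1 + a / r) := by
    calc _ ≤ ∑ k ∈ Finset.range K, (1 / 2 ^ (k + 1) : ℝ) * (k + Real.log (1 + a / r)) := by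
          gcongr with k _
          exact hle k
      _ = ∑ k ∈ Finset.range K, (1 / 2 ^ (k + 1) : ℝ) * k +
          (∑ k ∈ Finset.range K, (1 / 2 ^ (k + 1) : ℝ)) * Real.log (1 + a / r) := by
          rw [Finset.sum_mul, ← Finset.sum_add_distrib]
          exact Finset.sum_congr rfl fun k _ => by ring
      _ ≤ 1 + 1 * Real.log (1 + a / r) := by gcongr
      _ = _ := by ring
  have w4 : 0 ≤ ∑ k ∈ Finset.range K, (1 / 2 ^ (k + 1) : ℝ) * Real.log (1 + a / (r / 2 ^ k)) :=
    Finset.sum_nonneg fun k _ => mul_nonneg (by positivity) (hpt k)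
  calc _ ≤ 1 * (1 + Real.log (1 + a / r)) := by gcongr
    _ = _ := one_mul _

theorem aux_sqrt_add (x y : ℝ) (hx : 0 ≤ x) (hy : 0 ≤ y) :
    Real.sqrt (x + y) ≤ Real.sqrt x + Real.sqrt y := by
  apply Real.sqrt_le_iff.2 ⟨by positivity, ?_⟩
  have h1 := Real.sq_sqrt hx
  have h2 := Real.sq_sqrt hy
  have h3 : 0 ≤ Real.sqrt x * Real.sqrt y := by positivity
  nlinarith

theorem rad_dudley {ι : Type*} [Fintype ι] [DecidableEq ι] (S : Set (EuclideanSpace ℝ ι))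
    (R : ℝ) (hR : 0 < R) (hS : ∀ x ∈ S, ‖x‖ ≤ R) (p q : ℕ) (a b : ℝ) (ha : 0 ≤ a) (hb : 0 ≤ b)
    (hcov : ∀ ε : ℝ, 0 < ε → ∃ T : Finset (EuclideanSpace ℝ ι), (∀ x ∈ T, x ∈ S) ∧
      (T.card : ℝ) ≤ (1 + a / ε) ^ p * (1 + b / ε) ^ q ∧ ∀ x ∈ S, ∃ y ∈ T, ‖x - y‖ ≤ ε)
    (s : (ι → Bool) → EuclideanSpace ℝ ι) (hs : ∀ e, s e ∈ S) :
    (1 / 2 ^ (Fintype.card ι) : ℝ) * ∑ e : ι → Bool, rad e (s e) ≤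
      2 * Real.sqrt 2 * R * (Real.sqrt p * Real.sqrt (Real.log (Real.exp 1 * (1 + a / (R / 2)))) +
        Real.sqrt q * Real.sqrt (Real.log (Real.exp 1 * (1 + b / (R / 2))))) := by
  have hex : ∀ k : ℕ, ∃ T : Finset (EuclideanSpace ℝ ι), (∀ x ∈ T, x ∈ S) ∧
      (T.card : ℝ) ≤ (1 + a / (R / 2 ^ (k + 1))) ^ p * (1 + b / (R / 2 ^ (k + 1))) ^ q ∧
      ∀ x ∈ S, ∃ y ∈ T, ‖x - y‖ ≤ R / 2 ^ (k + 1) := fun k => hcov _ (by positivity)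
  choose T hT1 hT2 hT3 using hex
  set X := 2 * Real.sqrt 2 * R *
    (Real.sqrt p * Real.sqrt (Real.log (Real.exp 1 * (1 + a / (R / 2)))) +
        Real.sqrt q * Real.sqrt (Real.log (Real.exp 1 * (1 + b / (R / 2))))) with hX
  have hterm : ∀ k : ℕ, R / 2 ^ k * Real.sqrt (2 * Real.log (T k).card) ≤
      2 * Real.sqrt 2 * R * (Real.sqrt p *
        ((1 / 2 ^ (k + 1) : ℝ) * Real.sqrt (Real.log (1 + a / ((R / 2) / 2 ^ k)))) +
        Real.sqrt q * ((1 / 2 ^ (k + 1) : ℝ) *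
          Real.sqrt (Real.log (1 + b / ((R / 2) / 2 ^ k))))) := by
    intro k
    have hk : R / 2 ^ (k + 1) = (R / 2) / 2 ^ k := by rw [pow_succ]; field_simp
    have h2 := hT2 k
    rw [hk] at h2
    have hu : 0 ≤ a / ((R / 2) / 2 ^ k) := by positivity
    have hv : 0 ≤ b / ((R / 2) / 2 ^ k) := by positivity
    set u := a / ((R / 2) / 2 ^ k)
    set v := b / ((R / 2) / 2 ^ k)
    have hne : (1 : ℝ) ≤ (T k).card := by
      obtain ⟨y, hy, _⟩ := hT3 k _ (hs (fun _ => true))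
      exact_mod_cast Finset.card_pos.2 ⟨y, hy⟩
    have hlog : Real.log (T k).card ≤ p * Real.log (1 + u) + q * Real.log (1 + v) := by
      have := Real.log_le_log (by positivity) h2
      rwa [Real.log_mul (by positivity) (by positivity), Real.log_pow, Real.log_pow] at this
    have hlu : 0 ≤ Real.log (1 + u) := Real.log_nonneg (by linarith)
    have hlv : 0 ≤ Real.log (1 + v) := Real.log_nonneg (by linarith)
    have hsq : Real.sqrt (2 * Real.log (T k).card) ≤ Real.sqrt 2 *
        (Real.sqrt p * Real.sqrt (Real.log (1 + u)) + Real.sqrt q * Real.sqrt (Real.log (1 + v))) := by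
      rw [Real.sqrt_mul (by norm_num)]
      gcongr
      refine (Real.sqrt_le_sqrt hlog).trans ?_
      rw [← Real.sqrt_mul (by positivity), ← Real.sqrt_mul (by positivity)]
      exact aux_sqrt_add _ _ (by positivity) (by positivity)
    calc _ ≤ R / 2 ^ k * (Real.sqrt 2 *
        (Real.sqrt p * Real.sqrt (Real.log (1 + u)) + Real.sqrt q * Real.sqrt (Real.log (1 + v)))) := by
          gcongr
      _ = _ := by rw [pow_succ]; field_simp
  have hsum : ∀ K : ℕ, ∑ k ∈ Finset.range (K + 1), R / 2 ^ k * Real.sqrt (2 * Real.log (T k).card)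
      ≤ X := by
    intro K
    refine (Finset.sum_le_sum fun k _ => hterm k).trans ?_
    rw [← Finset.mul_sum, Finset.sum_add_distrib, ← Finset.mul_sum, ← Finset.mul_sum, hX]
    have h1 := entropy_sum (R / 2) a (by positivity) ha (K + 1)
    have h2 := entropy_sum (R / 2) b (by positivity) hb (K + 1)
    gcongr
  have hall : ∀ K : ℕ, (1 / 2 ^ (Fintype.card ι) : ℝ) * ∑ e : ι → Bool, rad e (s e) ≤
      X + Real.sqrt (Fintype.card ι) * R * (1 / 2) ^ (K + 1) := by
    intro K
    have hex : ∀ e, ∃ y ∈ T K, ‖s e - y‖ ≤ R / 2 ^ (K + 1) := fun e => hT3 K _ (hs e)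
    choose t ht1 ht2 using hex
    have h1 := rad_chain S R hR hS T hT1 hT3 K t ht1
    have h2 : ∀ e, rad e (s e) ≤ rad e (t e) +
        Real.sqrt (Fintype.card ι) * (R / 2 ^ (K + 1)) := by
      intro e
      have h3 := rad_abs_le e (s e - t e)
      rw [rad_sub] at h3
      have h4 : Real.sqrt (Fintype.card ι) * ‖s e - t e‖ ≤
        Real.sqrt (Fintype.card ι) * (R / 2 ^ (K + 1)) := by gcongr; exact ht2 e
      linarith
    calc _ ≤ (1 / 2 ^ (Fintype.card ι) : ℝ) * ∑ e : ι → Bool, (rad e (t e) +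
        Real.sqrt (Fintype.card ι) * (R / 2 ^ (K + 1))) := by
          gcongr with e; exact h2 e
      _ = (1 / 2 ^ (Fintype.card ι) : ℝ) * ∑ e : ι → Bool, rad e (t e) +
        Real.sqrt (Fintype.card ι) * (R / 2 ^ (K + 1)) := by
          rw [Finset.sum_add_distrib, mul_add]
          congr 1
          simp [Finset.card_univ]
      _ ≤ X + Real.sqrt (Fintype.card ι) * (R / 2 ^ (K + 1)) := by
          have := hsum K
          linarith
      _ = _ := by rw [one_div, inv_pow]; ring
  have hlim : Filter.Tendsto (fun K : ℕ => X + Real.sqrt (Fintype.card ι) * R * (1 / 2) ^ (K + 1))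
      Filter.atTop (nhds (X + Real.sqrt (Fintype.card ι) * R * 0)) := by
    apply Filter.Tendsto.const_add
    apply Filter.Tendsto.const_mul
    exact (tendsto_pow_atTop_nhds_zero_of_lt_one (by norm_num) (by norm_num)).comp
      (Filter.tendsto_add_atTop_nat 1)
  have := ge_of_tendsto' hlim hall
  simpa using this

open scoped Matrix.Norms.L2Operator in
theorem specNorm_eq {a b : ℕ} (A : Matrix (Fin a) (Fin b) ℝ) : specNorm A = ‖A‖ := rfl

noncomputable def toV {a b : ℕ} (M : Matrix (Fin a) (Fin b) ℝ) :
    EuclideanSpace ℝ (Fin b × Fin a) := WithLp.toLp 2 fun p => M p.2 p.1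

noncomputable def colV {a b : ℕ} (M : Matrix (Fin a) (Fin b) ℝ) (j : Fin b) :
    EuclideanSpace ℝ (Fin a) := WithLp.toLp 2 fun i => M i j

theorem toV_sub {a b : ℕ} (M M' : Matrix (Fin a) (Fin b) ℝ) : toV (M - M') = toV M - toV M' := by
  ext; simp [toV]

theorem toV_add {a b : ℕ} (M M' : Matrix (Fin a) (Fin b) ℝ) : toV (M + M') = toV M + toV M' := by
  ext; simp [toV]

theorem toV_smul {a b : ℕ} (c : ℝ) (M : Matrix (Fin a) (Fin b) ℝ) : toV (c • M) = c • toV M := by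
  ext; simp [toV]

theorem toV_zero {a b : ℕ} : toV (0 : Matrix (Fin a) (Fin b) ℝ) = 0 := by
  ext; simp [toV]

theorem colV_sub {a b : ℕ} (M M' : Matrix (Fin a) (Fin b) ℝ) (j : Fin b) :
    colV (M - M') j = colV M j - colV M' j := by
  ext; simp [colV]

theorem toV_norm_sq {a b : ℕ} (M : Matrix (Fin a) (Fin b) ℝ) :
    ‖toV M‖ ^ 2 = ∑ j, ‖colV M j‖ ^ 2 := by
  simp [EuclideanSpace.norm_sq_eq, toV, colV, Fintype.sum_prod_type]

theorem toV_norm {a b : ℕ} (M : Matrix (Fin a) (Fin b) ℝ) : ‖toV M‖ = frobNorm M := by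
  rw [EuclideanSpace.norm_eq, frobNorm, Fintype.sum_prod_type, Finset.sum_comm]
  simp [toV]

theorem l2_eq {a : ℕ} (x : Fin a → ℝ) : l2 x = ‖(WithLp.toLp 2 x : EuclideanSpace ℝ (Fin a))‖ := by
  rw [EuclideanSpace.norm_eq, l2]
  simp

theorem toV_le_of_col {a b c : ℕ} (M : Matrix (Fin a) (Fin b) ℝ) (M' : Matrix (Fin c) (Fin b) ℝ)
    (K : ℝ) (hK : 0 ≤ K) (h : ∀ j, ‖colV M j‖ ≤ K * ‖colV M' j‖) : ‖toV M‖ ≤ K * ‖toV M'‖ := by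
  refine (sq_le_sq₀ (norm_nonneg _) (by positivity)).1 ?_
  rw [mul_pow, toV_norm_sq, toV_norm_sq, Finset.mul_sum]
  apply Finset.sum_le_sum
  intro j _
  rw [← mul_pow]
  have := h j
  gcongr

theorem specNorm_nonneg {a b : ℕ} (A : Matrix (Fin a) (Fin b) ℝ) : 0 ≤ specNorm A := norm_nonneg _

theorem frobNorm_nonneg {a b : ℕ} (A : Matrix (Fin a) (Fin b) ℝ) : 0 ≤ frobNorm A :=
  Real.sqrt_nonneg _

open scoped Matrix.Norms.L2Operator in
theorem toV_mul_le {a b c : ℕ} (A : Matrix (Fin a) (Fin b) ℝ) (M : Matrix (Fin b) (Fin c) ℝ) :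
    ‖toV (A * M)‖ ≤ specNorm A * ‖toV M‖ := by
  apply toV_le_of_col _ _ _ (specNorm_nonneg A)
  intro j
  exact l2_opNorm_mulVec A (colV M j)

open scoped Matrix.Norms.L2Operator in
theorem specNorm_mul {a b c : ℕ} (A : Matrix (Fin a) (Fin b) ℝ) (M : Matrix (Fin b) (Fin c) ℝ) :
    specNorm (A * M) ≤ specNorm A * specNorm M := l2_opNorm_mul A M

open scoped Matrix.Norms.L2Operator in
theorem specNorm_transpose {a b : ℕ} (A : Matrix (Fin a) (Fin b) ℝ) :
    specNorm Aᵀ = specNorm A := by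
  have := l2_opNorm_conjTranspose A
  rwa [conjTranspose_eq_transpose_of_trivial] at this

open scoped Matrix.Norms.L2Operator in
theorem specNorm_add {a b : ℕ} (A B : Matrix (Fin a) (Fin b) ℝ) :
    specNorm (A + B) ≤ specNorm A + specNorm B := norm_add_le A B

open scoped Matrix.Norms.L2Operator in
theorem specNorm_one {a : ℕ} : specNorm (1 : Matrix (Fin a) (Fin a) ℝ) ≤ 1 := by
  rw [specNorm_eq, ← l2_opNorm_toEuclideanCLM, map_one]
  exact ContinuousLinearMap.norm_id_le

open scoped Matrix.Norms.L2Operator in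
theorem specNorm_orth {a : ℕ} (Φ : Matrix (Fin a) (Fin a) ℝ) (h : IsOrthogonal Φ) :
    specNorm Φ ≤ 1 := by
  have h1 := l2_opNorm_conjTranspose_mul_self Φ
  rw [conjTranspose_eq_transpose_of_trivial, h] at h1
  have h2 := specNorm_one (a := a)
  rw [specNorm_eq] at h2 ⊢
  have h3 := norm_nonneg Φ
  nlinarith

theorem soft_lip (mu : ℝ) (hmu : 0 ≤ mu) (x y : ℝ) : |soft mu x - soft mu y| ≤ |x - y| := by
  have key : ∀ x, soft mu x = x - max (-mu) (min mu x) := by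
    intro x
    unfold soft
    rcases lt_trichotomy x 0 with h | h | h
    · rw [Real.sign_of_neg h, abs_of_neg h, min_eq_right (by linarith)]
      rcases max_cases (0 : ℝ) (-x - mu) with h1 | h1 <;>
        rcases max_cases (-mu) x with h2 | h2 <;> linarith
    · subst h
      simp [hmu]
    · rw [Real.sign_of_pos h, abs_of_pos h]
      rcases max_cases (0 : ℝ) (x - mu) with h1 | h1 <;>
        rcases min_cases mu x with h3 | h3 <;>
        rcases max_cases (-mu) (min mu x) with h2 | h2 <;> linarith
  rw [key, key]
  rcases min_cases mu x with h3 | h3 <;>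
        rcases max_cases (-mu) (min mu x) with h2 | h2 <;>
    rcases min_cases mu y with h4 | h4 <;>
        rcases max_cases (-mu) (min mu y) with h5 | h5 <;>
    rw [abs_le] <;> rcases abs_cases (x - y) with h6 | h6 <;> constructor <;> linarith

theorem soft_zero (mu : ℝ) : soft mu 0 = 0 := by simp [soft]

theorem softMat_zero {a b : ℕ} (mu : ℝ) : softMat mu (0 : Matrix (Fin a) (Fin b) ℝ) = 0 := by
  ext; simp [softMat, soft_zero]

theorem softMat_lip {a b : ℕ} (mu : ℝ) (hmu : 0 ≤ mu) (M M' : Matrix (Fin a) (Fin b) ℝ) :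
    ‖toV (softMat mu M - softMat mu M')‖ ≤ ‖toV (M - M')‖ := by
  rw [EuclideanSpace.norm_eq, EuclideanSpace.norm_eq]
  apply Real.sqrt_le_sqrt
  apply Finset.sum_le_sum
  intro p _
  have := soft_lip mu hmu (M p.2 p.1) (M' p.2 p.1)
  simp only [toV, softMat, Matrix.sub_apply, Matrix.of_apply, Real.norm_eq_abs]
  gcongr

/-- projection onto a ball -/
noncomputable def projB {a : ℕ} (B : ℝ) (x : EuclideanSpace ℝ (Fin a)) :
    EuclideanSpace ℝ (Fin a) := if ‖x‖ ≤ B then x else (B / ‖x‖) • x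

theorem projB_norm {a : ℕ} (B : ℝ) (hB : 0 < B) (x : EuclideanSpace ℝ (Fin a)) :
    ‖projB B x‖ ≤ B := by
  unfold projB
  split_ifs with h
  · exact h
  · push Not at h
    rw [norm_smul, Real.norm_eq_abs, abs_of_nonneg (by positivity)]
    have : ‖x‖ ≠ 0 := by linarith
    rw [div_mul_cancel₀ _ this]

theorem projB_var {a : ℕ} (B : ℝ) (hB : 0 < B) (x z : EuclideanSpace ℝ (Fin a)) (hz : ‖z‖ ≤ B) :
    inner ℝ (x - projB B x) (z - projB B x) ≤ 0 := by
  unfold projB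
  split_ifs with h
  · simp
  · push Not at h
    have hx : 0 < ‖x‖ := by linarith
    have e1 : x - (B / ‖x‖) • x = (1 - B / ‖x‖) • x := by rw [sub_smul, one_smul]
    rw [e1, inner_smul_left, inner_sub_right, inner_smul_right, real_inner_self_eq_norm_sq]
    have h1 : 0 ≤ 1 - B / ‖x‖ := by
      rw [sub_nonneg, div_le_one hx]; exact h.le
    have h2 : inner ℝ x z ≤ ‖x‖ * B := (real_inner_le_norm x z).trans (by gcongr)
    have h3 : B / ‖x‖ * ‖x‖ ^ 2 = ‖x‖ * B := by field_simp
    rw [h3]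
    simp only [conj_trivial]
    exact mul_nonpos_of_nonneg_of_nonpos h1 (by linarith)

theorem projB_lip {a : ℕ} (B : ℝ) (hB : 0 < B) (x y : EuclideanSpace ℝ (Fin a)) :
    ‖projB B x - projB B y‖ ≤ ‖x - y‖ := by
  have h1 := projB_var B hB x (projB B y) (projB_norm B hB y)
  have h2 := projB_var B hB y (projB B x) (projB_norm B hB x)
  set u := projB B x
  set v := projB B y
  have h3 : ‖u - v‖ ^ 2 ≤ inner ℝ (x - y) (u - v) := by
    rw [← real_inner_self_eq_norm_sq]
    simp only [inner_sub_left, inner_sub_right] at *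
    linarith
  have h4 := real_inner_le_norm (x - y) (u - v)
  by_contra hcon
  push Not at hcon
  have : 0 ≤ ‖x - y‖ := norm_nonneg _
  nlinarith

theorem sigmaMat_col {N m : ℕ} (B : ℝ) (M : Matrix (Fin N) (Fin m) ℝ) (j : Fin m) :
    colV (sigmaMat B M) j = projB B (colV M j) := by
  unfold projB
  have e : ‖colV M j‖ = l2 (fun k => M k j) := by rw [l2_eq]; rfl
  ext i
  rw [e]
  simp only [colV, sigmaMat, sigma, Matrix.of_apply]
  split_ifs <;> simp

theorem sigmaMat_lip {N m : ℕ} (B : ℝ) (hB : 0 < B) (M M' : Matrix (Fin N) (Fin m) ℝ) :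
    ‖toV (sigmaMat B M - sigmaMat B M')‖ ≤ ‖toV (M - M')‖ := by
  have := toV_le_of_col (sigmaMat B M - sigmaMat B M') (M - M') 1 (by norm_num) (by
    intro j
    rw [colV_sub, colV_sub, sigmaMat_col, sigmaMat_col, one_mul]
    exact projB_lip B hB _ _)
  simpa using this

theorem sigmaMat_norm {N m : ℕ} (B : ℝ) (hB : 0 < B) (M : Matrix (Fin N) (Fin m) ℝ) :
    ‖toV (sigmaMat B M)‖ ≤ Real.sqrt m * B := by
  refine (sq_le_sq₀ (norm_nonneg _) (by positivity)).1 ?_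
  rw [mul_pow, Real.sq_sqrt (by positivity), toV_norm_sq]
  calc _ ≤ ∑ _j : Fin m, B ^ 2 := by
        apply Finset.sum_le_sum
        intro j _
        rw [sigmaMat_col]
        have := projB_norm B hB (colV M j)
        gcongr
    _ = _ := by simp

theorem gram_norm {n N : ℕ} (A : Matrix (Fin n) (Fin N) ℝ) (τ : ℝ)
    (Φ : Matrix (Fin N) (Fin N) ℝ) (h : IsOrthogonal Φ) :
    specNorm (1 - τ • (Φᵀ * Aᵀ * A * Φ)) ≤ specNorm (1 - τ • (Aᵀ * A)) := by
  have e : 1 - τ • (Φᵀ * Aᵀ * A * Φ) = Φᵀ * ((1 - τ • (Aᵀ * A)) * Φ) := by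
    rw [Matrix.sub_mul, Matrix.mul_sub, Matrix.one_mul, h]
    simp [Matrix.mul_assoc]
  rw [e]
  refine (specNorm_mul _ _).trans ?_
  rw [specNorm_transpose]
  have h1 := specNorm_orth Φ h
  have h2 := specNorm_mul (1 - τ • (Aᵀ * A)) Φ
  have h3 := specNorm_nonneg Φ
  have h4 := specNorm_nonneg (1 - τ • (Aᵀ * A))
  calc _ ≤ 1 * (specNorm (1 - τ • (Aᵀ * A)) * 1) := by
        apply mul_le_mul h1 _ (specNorm_nonneg _) zero_le_one
        exact h2.trans (by gcongr)
    _ = _ := by ring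

theorem AΦ_norm {n N : ℕ} (A : Matrix (Fin n) (Fin N) ℝ)
    (Φ : Matrix (Fin N) (Fin N) ℝ) (h : IsOrthogonal Φ) : specNorm (A * Φ) ≤ specNorm A := by
  have h1 := specNorm_orth Φ h
  have h4 := specNorm_nonneg A
  calc _ ≤ specNorm A * specNorm Φ := specNorm_mul _ _
    _ ≤ specNorm A * 1 := by gcongr
    _ = _ := by ring

theorem ista_norm {n N m : ℕ} (A : Matrix (Fin n) (Fin N) ℝ) (τ lam : ℝ) (hτ : 0 < τ)
    (hlam : 0 < lam) (Φ : Matrix (Fin N) (Fin N) ℝ) (h : IsOrthogonal Φ)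
    (Y : Matrix (Fin n) (Fin m) ℝ) (l : ℕ) :
    ‖toV (ista A τ lam Φ Y l)‖ ≤ ML A τ Y l := by
  induction l with
  | zero => simp [ista, ML, toV_zero]
  | succ l ih =>
    have h0 := softMat_lip (τ * lam) (by positivity)
      ((1 - τ • (Φᵀ * Aᵀ * A * Φ)) * ista A τ lam Φ Y l + τ • ((A * Φ)ᵀ * Y)) 0
    rw [softMat_zero, sub_zero, sub_zero] at h0
    have h1 := gram_norm A τ Φ h
    have h2 := AΦ_norm A Φ h
    have h3 := specNorm_nonneg (1 - τ • (Aᵀ * A))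
    have h4 := frobNorm_nonneg Y
    calc _ ≤ _ := h0
      _ ≤ ‖toV ((1 - τ • (Φᵀ * Aᵀ * A * Φ)) * ista A τ lam Φ Y l)‖ + τ * ‖toV ((A * Φ)ᵀ * Y)‖ := by
        rw [toV_add, toV_smul]
        refine (norm_add_le _ _).trans ?_
        rw [norm_smul, Real.norm_eq_abs, abs_of_pos hτ]
      _ ≤ specNorm (1 - τ • (Φᵀ * Aᵀ * A * Φ)) * ‖toV (ista A τ lam Φ Y l)‖ +
          τ * (specNorm (A * Φ)ᵀ * ‖toV Y‖) := by
        gcongr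
        · exact toV_mul_le _ _
        · exact toV_mul_le _ _
      _ ≤ specNorm (1 - τ • (Aᵀ * A)) * ML A τ Y l + τ * (specNorm A * frobNorm Y) := by
        rw [specNorm_transpose, toV_norm Y]
        gcongr
      _ = _ := by
        unfold ML
        rw [Finset.sum_range_succ', pow_zero]
        simp only [pow_succ, ← Finset.sum_mul]
        ring

theorem ML_nonneg {n N m : ℕ} (A : Matrix (Fin n) (Fin N) ℝ) (τ : ℝ) (hτ : 0 < τ)
    (Y : Matrix (Fin n) (Fin m) ℝ) (l : ℕ) : 0 ≤ ML A τ Y l := by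
  unfold ML
  have h3 := specNorm_nonneg (1 - τ • (Aᵀ * A))
  have h4 := frobNorm_nonneg Y
  have h5 := specNorm_nonneg A
  positivity

theorem KL_nonneg {n N m : ℕ} (A : Matrix (Fin n) (Fin N) ℝ) (τ : ℝ) (hτ : 0 < τ)
    (Y : Matrix (Fin n) (Fin m) ℝ) (l : ℕ) : 0 ≤ KL A τ Y l := by
  unfold KL
  have h3 := specNorm_nonneg (1 - τ • (Aᵀ * A))
  have h4 := frobNorm_nonneg Y
  have h5 := specNorm_nonneg A
  positivity

theorem KL_succ {n N m : ℕ} (A : Matrix (Fin n) (Fin N) ℝ) (τ : ℝ)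
    (Y : Matrix (Fin n) (Fin m) ℝ) (l : ℕ) :
    KL A τ Y (l + 2) = specNorm (1 - τ • (Aᵀ * A)) * KL A τ Y (l + 1) +
      τ * (2 * specNorm A) * ML A τ Y (l + 1) + τ * frobNorm Y := by
  unfold KL ML
  rw [Finset.sum_Icc_succ_top (by omega)]
  have e : ∑ k ∈ Finset.Icc 2 (l + 1), specNorm (1 - τ • (Aᵀ * A)) ^ (l + 1 + 1 - k) *
          (1 + 2 * τ * specNorm A ^ 2 *
            ∑ k ∈ Finset.range (k - 1), specNorm (1 - τ • (Aᵀ * A)) ^ k) =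
      specNorm (1 - τ • (Aᵀ * A)) * ∑ k ∈ Finset.Icc 2 (l + 1),
        specNorm (1 - τ • (Aᵀ * A)) ^ (l + 1 - k) *
          (1 + 2 * τ * specNorm A ^ 2 *
            ∑ k ∈ Finset.range (k - 1), specNorm (1 - τ • (Aᵀ * A)) ^ k) := by
    rw [Finset.mul_sum]
    apply Finset.sum_congr rfl
    intro k hk
    rw [Finset.mem_Icc] at hk
    have : l + 1 + 1 - k = (l + 1 - k) + 1 := by omega
    rw [this, pow_succ]
    ring
  rw [e]
  simp only [Nat.sub_self, pow_zero, Nat.add_sub_cancel, show l + 2 - 1 = l + 1 by omega, pow_succ]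
  ring

theorem gram_diff {n N : ℕ} (A : Matrix (Fin n) (Fin N) ℝ) (Φ Φ' : Matrix (Fin N) (Fin N) ℝ)
    (h : IsOrthogonal Φ) (h' : IsOrthogonal Φ') :
    specNorm (Φ'ᵀ * Aᵀ * A * Φ' - Φᵀ * Aᵀ * A * Φ) ≤
      2 * specNorm A * specNorm (A * Φ - A * Φ') := by
  have e : Φ'ᵀ * Aᵀ * A * Φ' - Φᵀ * Aᵀ * A * Φ =
      (A * Φ' - A * Φ)ᵀ * (A * Φ') + (A * Φ)ᵀ * (A * Φ' - A * Φ) := by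
    rw [Matrix.transpose_sub, Matrix.sub_mul, Matrix.mul_sub, Matrix.transpose_mul,
      Matrix.transpose_mul]
    simp only [Matrix.mul_assoc]
    abel
  have e2 : specNorm (A * Φ' - A * Φ) = specNorm (A * Φ - A * Φ') := by
    unfold specNorm
    rw [← norm_neg, ← map_neg, ← map_neg, neg_sub]
  rw [e]
  refine (specNorm_add _ _).trans ?_
  have h1 := specNorm_mul (A * Φ' - A * Φ)ᵀ (A * Φ')
  have h2 := specNorm_mul (A * Φ)ᵀ (A * Φ' - A * Φ)
  rw [specNorm_transpose, e2] at h1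
  rw [specNorm_transpose, e2] at h2
  have h3 := AΦ_norm A Φ h
  have h4 := AΦ_norm A Φ' h'
  have h5 := specNorm_nonneg (A * Φ - A * Φ')
  nlinarith

theorem ista_lip {n N m : ℕ} (A : Matrix (Fin n) (Fin N) ℝ) (τ lam : ℝ) (hτ : 0 < τ)
    (hlam : 0 < lam) (Φ Φ' : Matrix (Fin N) (Fin N) ℝ) (h : IsOrthogonal Φ) (h' : IsOrthogonal Φ')
    (Y : Matrix (Fin n) (Fin m) ℝ) (l : ℕ) :
    ‖toV (ista A τ lam Φ Y (l + 1) - ista A τ lam Φ' Y (l + 1))‖ ≤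
      KL A τ Y (l + 1) * specNorm (A * Φ - A * Φ') := by
  have hY : ‖toV ((A * Φ)ᵀ * Y - (A * Φ')ᵀ * Y)‖ ≤ specNorm (A * Φ - A * Φ') * frobNorm Y := by
    rw [← Matrix.sub_mul, ← Matrix.transpose_sub, ← toV_norm, ← specNorm_transpose]
    exact toV_mul_le _ _
  induction l with
  | zero =>
    refine (softMat_lip (τ * lam) (by positivity) _ _).trans ?_
    simp only [ista, Matrix.mul_zero, zero_add]
    rw [← smul_sub, toV_smul, norm_smul, Real.norm_eq_abs, abs_of_pos hτ]
    have e : KL A τ Y (0 + 1) = τ * frobNorm Y := by simp [KL]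
    rw [e]
    nlinarith
  | succ l ih =>
    refine (softMat_lip (τ * lam) (by positivity) _ _).trans ?_
    set f := ista A τ lam Φ Y (l + 1)
    set f' := ista A τ lam Φ' Y (l + 1)
    have hf' : ‖toV f'‖ ≤ ML A τ Y (l + 1) := ista_norm A τ lam hτ hlam Φ' h' Y (l + 1)
    have e : (1 - τ • (Φᵀ * Aᵀ * A * Φ)) * f + τ • ((A * Φ)ᵀ * Y) -
        ((1 - τ • (Φ'ᵀ * Aᵀ * A * Φ')) * f' + τ • ((A * Φ')ᵀ * Y)) =
        (1 - τ • (Φᵀ * Aᵀ * A * Φ)) * (f - f') +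
        τ • ((Φ'ᵀ * Aᵀ * A * Φ' - Φᵀ * Aᵀ * A * Φ) * f') +
        τ • ((A * Φ)ᵀ * Y - (A * Φ')ᵀ * Y) := by
      simp only [Matrix.sub_mul, Matrix.mul_sub, smul_sub, Matrix.smul_mul, Matrix.one_mul]
      abel
    rw [e, toV_add, toV_add, toV_smul, toV_smul]
    have h1 := gram_norm A τ Φ h
    have h3 := specNorm_nonneg (1 - τ • (Aᵀ * A))
    have h4 := frobNorm_nonneg Y
    have h5 := specNorm_nonneg A
    have h6 := specNorm_nonneg (A * Φ - A * Φ')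
    calc _ ≤ ‖toV ((1 - τ • (Φᵀ * Aᵀ * A * Φ)) * (f - f'))‖ +
          τ * ‖toV ((Φ'ᵀ * Aᵀ * A * Φ' - Φᵀ * Aᵀ * A * Φ) * f')‖ +
          τ * ‖toV ((A * Φ)ᵀ * Y - (A * Φ')ᵀ * Y)‖ := by
          refine (norm_add₃_le).trans ?_
          rw [norm_smul, norm_smul, Real.norm_eq_abs, abs_of_pos hτ]
      _ ≤ specNorm (1 - τ • (Aᵀ * A)) * (KL A τ Y (l + 1) * specNorm (A * Φ - A * Φ')) +
          τ * ((2 * specNorm A * specNorm (A * Φ - A * Φ')) * ML A τ Y (l + 1)) +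
          τ * (specNorm (A * Φ - A * Φ') * frobNorm Y) := by
          gcongr
          · exact (toV_mul_le _ _).trans (by gcongr)
          · refine (toV_mul_le _ _).trans ?_
            have := gram_diff A Φ Φ' h h'
            gcongr
      _ = _ := by
          rw [KL_succ]; ring

theorem class_lip {n N m : ℕ} (A : Matrix (Fin n) (Fin N) ℝ) (τ lam : ℝ) (hτ : 0 < τ)
    (hlam : 0 < lam) (Ψ Ψ' Φ Φ' : Matrix (Fin N) (Fin N) ℝ) (hΨ' : IsOrthogonal Ψ')
    (h : IsOrthogonal Φ) (h' : IsOrthogonal Φ')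
    (Y : Matrix (Fin n) (Fin m) ℝ) (L : ℕ) (hL : 2 ≤ L) (B : ℝ) (hB : 0 < B) :
    ‖toV (sigmaMat B (Ψ * ista A τ lam Φ Y L)) - toV (sigmaMat B (Ψ' * ista A τ lam Φ' Y L))‖ ≤
      ML A τ Y L * specNorm (Ψ - Ψ') + KL A τ Y L * specNorm (A * Φ - A * Φ') := by
  obtain ⟨l, rfl⟩ : ∃ l, L = l + 1 := ⟨L - 1, by omega⟩
  rw [← toV_sub]
  refine (sigmaMat_lip B hB _ _).trans ?_
  have h1 := ista_norm A τ lam hτ hlam Φ h Y (l + 1)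
  have h2 := ista_lip A τ lam hτ hlam Φ Φ' h h' Y l
  set f := ista A τ lam Φ Y (l + 1)
  set f' := ista A τ lam Φ' Y (l + 1)
  have e : Ψ * f - Ψ' * f' = (Ψ - Ψ') * f + Ψ' * (f - f') := by
    rw [Matrix.sub_mul, Matrix.mul_sub]; abel
  rw [e, toV_add]
  have h3 := toV_mul_le (Ψ - Ψ') f
  have h4 := toV_mul_le Ψ' (f - f')
  have h5 := specNorm_orth Ψ' hΨ'
  have h6 := specNorm_nonneg (Ψ - Ψ')
  have h7 : 0 ≤ ‖toV (f - f')‖ := norm_nonneg _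
  have h8 := norm_add_le (toV ((Ψ - Ψ') * f)) (toV (Ψ' * (f - f')))
  nlinarith

/-- the hypothesis class -/
def classS {n N m : ℕ} (A : Matrix (Fin n) (Fin N) ℝ) (τ lam : ℝ)
    (Y : Matrix (Fin n) (Fin m) ℝ) (L : ℕ) (B : ℝ) : Set (EuclideanSpace ℝ (Fin m × Fin N)) :=
  {x | ∃ Ψ : Matrix (Fin N) (Fin N) ℝ, IsOrthogonal Ψ ∧ ∃ Φ : Matrix (Fin N) (Fin N) ℝ,
    IsOrthogonal Φ ∧ x = toV (sigmaMat B (Ψ * ista A τ lam Φ Y L))}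

open scoped Matrix.Norms.L2Operator in
theorem class_cover {n N m : ℕ} (A : Matrix (Fin n) (Fin N) ℝ) (τ lam : ℝ) (hτ : 0 < τ)
    (hlam : 0 < lam) (Y : Matrix (Fin n) (Fin m) ℝ) (L : ℕ) (hL : 2 ≤ L) (B : ℝ) (hB : 0 < B)
    (ε : ℝ) (hε : 0 < ε) :
    ∃ T : Finset (EuclideanSpace ℝ (Fin m × Fin N)), (∀ x ∈ T, x ∈ classS A τ lam Y L B) ∧
      (T.card : ℝ) ≤ (1 + (4 * ML A τ Y L) / ε) ^ (N * N) *
        (1 + (4 * KL A τ Y L * specNorm A) / ε) ^ (n * N) ∧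
      ∀ x ∈ classS A τ lam Y L B, ∃ y ∈ T, ‖x - y‖ ≤ ε := by
  classical
  have hone : IsOrthogonal (1 : Matrix (Fin N) (Fin N) ℝ) := by simp [IsOrthogonal]
  obtain ⟨T1, a1, a2, a3⟩ := aux_cover {Ψ : Matrix (Fin N) (Fin N) ℝ | IsOrthogonal Ψ}
    ⟨1, hone⟩ 1 (ML A τ Y L) (ε / 2) zero_le_one (ML_nonneg A τ hτ Y L) (by positivity)
    (fun x hx => specNorm_orth x hx)
  obtain ⟨T2, b1, b2, b3⟩ := aux_cover
    {M : Matrix (Fin n) (Fin N) ℝ | ∃ Φ : Matrix (Fin N) (Fin N) ℝ, IsOrthogonal Φ ∧ M = A * Φ}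
    ⟨A * 1, 1, hone, rfl⟩ (specNorm A) (KL A τ Y L) (ε / 2) (specNorm_nonneg A)
    (KL_nonneg A τ hτ Y L) (by positivity)
    (by rintro x ⟨Φ, hΦ, rfl⟩; exact AΦ_norm A Φ hΦ)
  have hex : ∀ M : Matrix (Fin n) (Fin N) ℝ, ∃ Φ : Matrix (Fin N) (Fin N) ℝ,
      M ∈ T2 → IsOrthogonal Φ ∧ M = A * Φ := by
    intro M
    by_cases hM : M ∈ T2
    · obtain ⟨Φ, h⟩ := b1 M hM
      exact ⟨Φ, fun _ => h⟩
    · exact ⟨0, fun h => absurd h hM⟩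
  choose g hg using hex
  refine ⟨(T1 ×ˢ T2).image fun p => toV (sigmaMat B (p.1 * ista A τ lam (g p.2) Y L)), ?_, ?_, ?_⟩
  · intro x hx
    obtain ⟨p, hp, rfl⟩ := Finset.mem_image.1 hx
    rw [Finset.mem_product] at hp
    exact ⟨p.1, a1 _ hp.1, g p.2, (hg _ hp.2).1, rfl⟩
  · have hc : (((T1 ×ˢ T2).image fun p => toV (sigmaMat B (p.1 * ista A τ lam (g p.2) Y L))).card : ℝ)
        ≤ T1.card * T2.card := by
      rw [← Nat.cast_mul, ← Finset.card_product]
      exact_mod_cast Finset.card_image_le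
    refine hc.trans ?_
    rw [Module.finrank_matrix] at a2 b2
    simp only [Fintype.card_fin, Module.finrank_self, mul_one] at a2 b2
    have e1 : 2 * ML A τ Y L / (ε / 2) = (4 * ML A τ Y L) / ε := by field_simp; ring
    have e2 : 2 * specNorm A * KL A τ Y L / (ε / 2) = (4 * KL A τ Y L * specNorm A) / ε := by
      field_simp; ring
    rw [e1] at a2
    rw [e2] at b2
    have := ML_nonneg A τ hτ Y L
    gcongr
  · rintro x ⟨Ψ, hΨ, Φ, hΦ, rfl⟩
    obtain ⟨Ψ', c1, c2⟩ := a3 Ψ hΨ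
    obtain ⟨M, d1, d2⟩ := b3 (A * Φ) ⟨Φ, hΦ, rfl⟩
    obtain ⟨f1, f2⟩ := hg M d1
    refine ⟨_, Finset.mem_image.2 ⟨(Ψ', M), Finset.mem_product.2 ⟨c1, d1⟩, rfl⟩, ?_⟩
    have := class_lip A τ lam hτ hlam Ψ Ψ' Φ (g M) (a1 _ c1) hΦ f1 Y L hL B hB
    rw [← f2, specNorm_eq, specNorm_eq] at this
    simp only
    linarith

theorem rad_toV {N m : ℕ} (e : Fin m → Fin N → Bool) (M : Matrix (Fin N) (Fin m) ℝ) :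
    rad (Function.uncurry e) (toV M) =
      ∑ i : Fin m, ∑ k : Fin N, (if e i k then (1 : ℝ) else -1) * M k i := by
  simp only [rad, toV, Fintype.sum_prod_type, Function.uncurry]
  rfl

theorem class_bound {n N m : ℕ} (hm : 0 < m) (A : Matrix (Fin n) (Fin N) ℝ)
    (τ lam : ℝ) (hτ : 0 < τ) (hlam : 0 < lam)
    (Y : Matrix (Fin n) (Fin m) ℝ) (L : ℕ) (hL : 2 ≤ L) (Bout : ℝ) (hBout : 0 < Bout)
    (s : (Fin m × Fin N → Bool) → EuclideanSpace ℝ (Fin m × Fin N))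
    (hs : ∀ e, s e ∈ classS A τ lam Y L Bout) :
    (1 / (m : ℝ)) * ((1 / 2 ^ (m * N) : ℝ) * ∑ e, rad e (s e)) ≤
      2 * Real.sqrt 2 * Bout * ((N : ℝ) / Real.sqrt (m : ℝ)) *
        Real.sqrt (Real.log (Real.exp 1 *
          (1 + 8 * ML A τ Y L / (Real.sqrt (m : ℝ) * Bout)))) +
      2 * Real.sqrt 2 * Bout * Real.sqrt ((N : ℝ) * (n : ℝ) / (m : ℝ)) *
        Real.sqrt (Real.log (Real.exp 1 *
          (1 + 8 * KL A τ Y L * specNorm A / (Real.sqrt (m : ℝ) * Bout)))) := by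
  have hm' : (0 : ℝ) < m := by exact_mod_cast hm
  have hsm : 0 < Real.sqrt m := Real.sqrt_pos.2 hm'
  have hM := ML_nonneg A τ hτ Y L
  have hK := KL_nonneg A τ hτ Y L
  have hA := specNorm_nonneg A
  have hd := rad_dudley (classS A τ lam Y L Bout) (Real.sqrt m * Bout) (by positivity)
    (by rintro x ⟨Ψ, _, Φ, _, rfl⟩; exact sigmaMat_norm Bout hBout _)
    (N * N) (n * N) (4 * ML A τ Y L) (4 * KL A τ Y L * specNorm A) (by positivity) (by positivity)
    (fun ε hε => class_cover A τ lam hτ hlam Y L hL Bout hBout ε hε) s hs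
  have e1 : 4 * ML A τ Y L / (Real.sqrt m * Bout / 2) =
      8 * ML A τ Y L / (Real.sqrt (m : ℝ) * Bout) := by field_simp; ring
  have e2 : 4 * KL A τ Y L * specNorm A / (Real.sqrt m * Bout / 2) =
      8 * KL A τ Y L * specNorm A / (Real.sqrt (m : ℝ) * Bout) := by field_simp; ring
  have e3 : Real.sqrt ((N * N : ℕ) : ℝ) = N := by
    push_cast; exact Real.sqrt_mul_self (by positivity)
  have e4 : Real.sqrt ((N : ℝ) * (n : ℝ) / (m : ℝ)) =
      Real.sqrt ((n * N : ℕ) : ℝ) / Real.sqrt m := by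
    rw [Real.sqrt_div (by positivity)]; push_cast; rw [mul_comm]
  rw [e1, e2, e3] at hd
  rw [e4]
  rw [Fintype.card_prod, Fintype.card_fin, Fintype.card_fin] at hd
  refine (mul_le_mul_of_nonneg_left hd (by positivity : (0 : ℝ) ≤ 1 / m)).trans (le_of_eq ?_)
  have e5 : (1 / (m : ℝ)) * Real.sqrt m = 1 / Real.sqrt m := by
    rw [div_mul_eq_mul_div, one_mul, Real.sqrt_div_self]
    simp
  generalize Real.sqrt (Real.log (Real.exp 1 *
          (1 + 8 * ML A τ Y L / (Real.sqrt (m : ℝ) * Bout)))) = U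
  generalize Real.sqrt (Real.log (Real.exp 1 *
          (1 + 8 * KL A τ Y L * specNorm A / (Real.sqrt (m : ℝ) * Bout)))) = V
  calc _ = 2 * Real.sqrt 2 * Bout * ((1 / (m : ℝ)) * Real.sqrt m) *
        (N * U + Real.sqrt ((n * N : ℕ) : ℝ) * V) := by ring
    _ = _ := by rw [e5]; ring

theorem statement15 {n N m : ℕ} (A : Matrix (Fin n) (Fin N) ℝ)
    (τ lam : ℝ) (hτ : 0 < τ) (hlam : 0 < lam)
    (Y : Matrix (Fin n) (Fin m) ℝ) (L : ℕ) (hL : 2 ≤ L) (Bout : ℝ) (hBout : 0 < Bout) :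
    (1 / 2 ^ (m * N) : ℝ) *
      ∑ e : Fin m → Fin N → Bool,
        sSup {r : ℝ | ∃ Ψ : Matrix (Fin N) (Fin N) ℝ, IsOrthogonal Ψ ∧
          ∃ Φ : Matrix (Fin N) (Fin N) ℝ, IsOrthogonal Φ ∧
            r = (1 / (m : ℝ)) * ∑ i : Fin m, ∑ k : Fin N,
              (if e i k then (1 : ℝ) else -1) *
                sigmaMat Bout (Ψ * ista A τ lam Φ Y L) k i} ≤
      2 * Real.sqrt 2 * Bout * ((N : ℝ) / Real.sqrt (m : ℝ)) *
        Real.sqrt (Real.log (Real.exp 1 *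
          (1 + 8 * ML A τ Y L / (Real.sqrt (m : ℝ) * Bout)))) +
      2 * Real.sqrt 2 * Bout * Real.sqrt ((N : ℝ) * (n : ℝ) / (m : ℝ)) *
        Real.sqrt (Real.log (Real.exp 1 *
          (1 + 8 * KL A τ Y L * specNorm A / (Real.sqrt (m : ℝ) * Bout)))) := by
  rcases Nat.eq_zero_or_pos m with rfl | hm
  · have hset : {r : ℝ | (∃ Ψ : Matrix (Fin N) (Fin N) ℝ, IsOrthogonal Ψ) ∧ r = 0} = {0} := by
      ext r
      constructor
      · rintro ⟨_, h⟩; exact h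
      · rintro h
        exact ⟨⟨1, by simp [IsOrthogonal]⟩, h⟩
    simp [hset]
  apply le_of_forall_pos_le_add
  intro η hη
  have hex : ∀ e : Fin m × Fin N → Bool, ∃ x ∈ classS A τ lam Y L Bout,
      sSup {r : ℝ | ∃ Ψ : Matrix (Fin N) (Fin N) ℝ, IsOrthogonal Ψ ∧
          ∃ Φ : Matrix (Fin N) (Fin N) ℝ, IsOrthogonal Φ ∧
            r = (1 / (m : ℝ)) * ∑ i : Fin m, ∑ k : Fin N,
              (if (Function.curry e) i k then (1 : ℝ) else -1) *
                sigmaMat Bout (Ψ * ista A τ lam Φ Y L) k i} ≤ (1 / (m : ℝ)) * rad e x + η := by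
    intro e
    have hone : IsOrthogonal (1 : Matrix (Fin N) (Fin N) ℝ) := by simp [IsOrthogonal]
    obtain ⟨r, ⟨Ψ, hΨ, Φ, hΦ, rfl⟩, hr⟩ := exists_lt_of_lt_csSup
      (s := {r : ℝ | ∃ Ψ : Matrix (Fin N) (Fin N) ℝ, IsOrthogonal Ψ ∧
          ∃ Φ : Matrix (Fin N) (Fin N) ℝ, IsOrthogonal Φ ∧
            r = (1 / (m : ℝ)) * ∑ i : Fin m, ∑ k : Fin N,
              (if (Function.curry e) i k then (1 : ℝ) else -1) *
                sigmaMat Bout (Ψ * ista A τ lam Φ Y L) k i})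
      ⟨_, 1, hone, 1, hone, rfl⟩ (sub_lt_self _ hη)
    refine ⟨_, ⟨Ψ, hΨ, Φ, hΦ, rfl⟩, ?_⟩
    rw [← rad_toV, Function.uncurry_curry] at hr
    linarith
  choose s hs1 hs2 using hex
  have hb := class_bound hm A τ lam hτ hlam Y L hL Bout hBout s hs1
  refine le_trans ?_ (add_le_add_left hb η)
  rw [← (Equiv.curry (Fin m) (Fin N) Bool).sum_comp]
  calc _ ≤ (1 / 2 ^ (m * N) : ℝ) * ∑ e : Fin m × Fin N → Bool, ((1 / (m : ℝ)) * rad e (s e) + η) := by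
        gcongr with e
        exact hs2 e
    _ = _ := by
        rw [Finset.sum_add_distrib, mul_add, ← Finset.mul_sum]
        congr 1
        · ring
        · simp [Finset.card_univ]
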